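/- Let (A,≺,≻) be a pre-anti-flexible algebra over a field F of characteristic 0 and r≺, r≻ ∈ A⊗A. Define Δ≻(x) := (id⊗L·(x))r≻ + (R≺(x)⊗id)σr≺ and Δ≺(x) := (id⊗L≻(x))r≺ + (R·(x)⊗id)σr≻ for x ∈ A. Then the identity σ(L·(y)⊗id − id⊗R≺(y))Δ≺(x) + (L≻(x)⊗id − id⊗R·(x))Δ≻(y) = σ(L·(x)⊗id − id⊗R≺(x))Δ≺(y) + (L≻(y)⊗id − id⊗R·(y))Δ≻(x) holds for all x, y ∈ A if and only if (L≻(x)⊗L·(y) − R≺(y)⊗R·(x) − L≻(y)⊗L·(x) + R≺(x)⊗R·(y))(r≻ + σr≺) = 0 for all x, y ∈ A. -/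

import Mathlib

open TensorProduct

/-- Pre-anti-flexible algebra structure on a pair of bilinear products `(≺, ≻) = (p, s)`. -/
def IsPreAntiFlexible {F A : Type*} [Field F] [AddCommGroup A] [Module F A]
    (p s : A →ₗ[F] A →ₗ[F] A) : Prop :=
  (∀ x y z : A, p (s x y) z - s x (p y z) = p (s z y) x - s z (p y x)) ∧
  (∀ x y z : A, s (p x y + s x y) z - s x (s y z) = p (p z y) x - p z (p y x + s y x))

/-- The flip `σ` on `A ⊗ A`. -/
noncomputable def sigmaTensor (F A : Type*) [Field F] [AddCommGroup A] [Module F A] :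
    A ⊗[F] A →ₗ[F] A ⊗[F] A := (TensorProduct.comm F A A).toLinearMap

/-- `Δ≻(x) = (id ⊗ L·(x)) r≻ + (R≺(x) ⊗ id) σ r≺`, where `L·(x) = p x + s x` and
`R≺(x) = p.flip x`. -/
noncomputable def cobSucc {F A : Type*} [Field F] [AddCommGroup A] [Module F A]
    (p s : A →ₗ[F] A →ₗ[F] A) (rp rs : A ⊗[F] A) (x : A) : A ⊗[F] A :=
  TensorProduct.map LinearMap.id (p x + s x) rs
    + TensorProduct.map (p.flip x) LinearMap.id (sigmaTensor F A rp)

/-- `Δ≺(x) = (id ⊗ L≻(x)) r≺ + (R·(x) ⊗ id) σ r≻`, where `L≻(x) = s x` and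
`R·(x) = p.flip x + s.flip x`. -/
noncomputable def cobPrec {F A : Type*} [Field F] [AddCommGroup A] [Module F A]
    (p s : A →ₗ[F] A →ₗ[F] A) (rp rs : A ⊗[F] A) (x : A) : A ⊗[F] A :=
  TensorProduct.map LinearMap.id (s x) rp
    + TensorProduct.map (p.flip x + s.flip x) LinearMap.id (sigmaTensor F A rs)

/-- The sum of the two products of a pre-anti-flexible algebra is anti-flexible: its associator is
symmetric in the outer arguments. -/
theorem IsPreAntiFlexible.associator_symm {F A : Type*} [Field F] [AddCommGroup A] [Module F A]
    {p s : A →ₗ[F] A →ₗ[F] A} (hA : IsPreAntiFlexible p s) (x y z : A) :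
    (p (p x y + s x y) z + s (p x y + s x y) z) - (p x (p y z + s y z) + s x (p y z + s y z)) =
      (p (p z y + s z y) x + s (p z y + s z y) x)
        - (p z (p y x + s y x) + s z (p y x + s y x)) := by
  have h₁ := hA.1 x y z
  have h₂ := hA.2 x y z
  have h₃ := hA.2 z y x
  simp only [map_add, LinearMap.add_apply] at *
  linear_combination (norm := module) h₁ + h₂ - h₃

/-- The difference of the two sides of the coboundary identity is linear in `(r≺, r≻)`; this is the
contribution of `r≻`. -/
theorem coboundary_contribution_succ
    {F A : Type*} [Field F] [AddCommGroup A] [Module F A]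
    {p s : A →ₗ[F] A →ₗ[F] A} (hA : IsPreAntiFlexible p s) (rs : A ⊗[F] A) (x y : A) :
    (TensorProduct.map (s x) (p y + s y) - TensorProduct.map (p.flip y) (p.flip x + s.flip x)
          - TensorProduct.map (s y) (p x + s x)
          + TensorProduct.map (p.flip x) (p.flip y + s.flip y) :
            A ⊗[F] A →ₗ[F] A ⊗[F] A) rs =
      (sigmaTensor F A
          ((TensorProduct.map (p y + s y) LinearMap.id
              - TensorProduct.map LinearMap.id (p.flip y) :
                A ⊗[F] A →ₗ[F] A ⊗[F] A) (cobPrec p s 0 rs x))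
        + (TensorProduct.map (s x) LinearMap.id
            - TensorProduct.map LinearMap.id (p.flip x + s.flip x) :
              A ⊗[F] A →ₗ[F] A ⊗[F] A) (cobSucc p s 0 rs y))
      - (sigmaTensor F A
          ((TensorProduct.map (p x + s x) LinearMap.id
              - TensorProduct.map LinearMap.id (p.flip x) :
                A ⊗[F] A →ₗ[F] A ⊗[F] A) (cobPrec p s 0 rs y))
        + (TensorProduct.map (s y) LinearMap.id
            - TensorProduct.map LinearMap.id (p.flip y + s.flip y) :
              A ⊗[F] A →ₗ[F] A ⊗[F] A) (cobSucc p s 0 rs x)) := by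
  simp only [cobPrec, cobSucc, sigmaTensor, map_zero, zero_add, add_zero]
  induction rs using TensorProduct.induction_on with
  | zero => simp only [map_zero, sub_zero, add_zero]
  | add r₁ r₂ h₁ h₂ =>
    simp only [map_add, h₁, h₂]
    abel
  | tmul a b =>
    have h := congrArg (a ⊗ₜ[F] ·) (hA.associator_symm y b x)
    simp only [LinearMap.add_apply, LinearMap.sub_apply, TensorProduct.map_tmul,
      LinearEquiv.coe_coe, TensorProduct.comm_tmul, LinearMap.id_apply, LinearMap.flip_apply,
      map_add, map_sub, TensorProduct.tmul_add, TensorProduct.tmul_sub, TensorProduct.add_tmul] at h ⊢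
    linear_combination (norm := module) h

/-- The difference of the two sides of the coboundary identity is linear in `(r≺, r≻)`; this is the
contribution of `r≺`. -/
theorem coboundary_contribution_prec
    {F A : Type*} [Field F] [AddCommGroup A] [Module F A]
    {p s : A →ₗ[F] A →ₗ[F] A} (hA : IsPreAntiFlexible p s) (rp : A ⊗[F] A) (x y : A) :
    (TensorProduct.map (s x) (p y + s y) - TensorProduct.map (p.flip y) (p.flip x + s.flip x)
          - TensorProduct.map (s y) (p x + s x)
          + TensorProduct.map (p.flip x) (p.flip y + s.flip y) :
            A ⊗[F] A →ₗ[F] A ⊗[F] A) (sigmaTensor F A rp) =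
      (sigmaTensor F A
          ((TensorProduct.map (p y + s y) LinearMap.id
              - TensorProduct.map LinearMap.id (p.flip y) :
                A ⊗[F] A →ₗ[F] A ⊗[F] A) (cobPrec p s rp 0 x))
        + (TensorProduct.map (s x) LinearMap.id
            - TensorProduct.map LinearMap.id (p.flip x + s.flip x) :
              A ⊗[F] A →ₗ[F] A ⊗[F] A) (cobSucc p s rp 0 y))
      - (sigmaTensor F A
          ((TensorProduct.map (p x + s x) LinearMap.id
              - TensorProduct.map LinearMap.id (p.flip x) :
                A ⊗[F] A →ₗ[F] A ⊗[F] A) (cobPrec p s rp 0 y))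
        + (TensorProduct.map (s y) LinearMap.id
            - TensorProduct.map LinearMap.id (p.flip y + s.flip y) :
              A ⊗[F] A →ₗ[F] A ⊗[F] A) (cobSucc p s rp 0 x)) := by
  simp only [cobPrec, cobSucc, sigmaTensor, map_zero, zero_add, add_zero]
  induction rp using TensorProduct.induction_on with
  | zero => simp only [map_zero, sub_zero, add_zero]
  | add r₁ r₂ h₁ h₂ =>
    simp only [map_add, h₁, h₂]
    abel
  | tmul d c =>
    have h := congrArg (· ⊗ₜ[F] d) (hA.1 x c y)
    simp only [LinearMap.add_apply, LinearMap.sub_apply, TensorProduct.map_tmul,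
      LinearEquiv.coe_coe, TensorProduct.comm_tmul, LinearMap.id_apply, LinearMap.flip_apply,
      map_add, map_sub, TensorProduct.tmul_add, TensorProduct.add_tmul,
      TensorProduct.sub_tmul] at h ⊢
    linear_combination (norm := module) h

/-- the second coboundary compatibility identity for `Δ≺, Δ≻` holds iff
`(L≻(x)⊗L·(y) − R≺(y)⊗R·(x) − L≻(y)⊗L·(x) + R≺(x)⊗R·(y))(r≻ + σ r≺) = 0` for all `x, y`. -/
theorem coboundary_eq2_iff
    {F A : Type*} [Field F] [CharZero F] [AddCommGroup A] [Module F A]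
    (p s : A →ₗ[F] A →ₗ[F] A) (hA : IsPreAntiFlexible p s) (rp rs : A ⊗[F] A) :
    (∀ x y : A,
      sigmaTensor F A
          ((TensorProduct.map (p y + s y) LinearMap.id
              - TensorProduct.map LinearMap.id (p.flip y) :
                A ⊗[F] A →ₗ[F] A ⊗[F] A) (cobPrec p s rp rs x))
        + (TensorProduct.map (s x) LinearMap.id
            - TensorProduct.map LinearMap.id (p.flip x + s.flip x) :
              A ⊗[F] A →ₗ[F] A ⊗[F] A) (cobSucc p s rp rs y)
      = sigmaTensor F A
          ((TensorProduct.map (p x + s x) LinearMap.id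
              - TensorProduct.map LinearMap.id (p.flip x) :
                A ⊗[F] A →ₗ[F] A ⊗[F] A) (cobPrec p s rp rs y))
        + (TensorProduct.map (s y) LinearMap.id
            - TensorProduct.map LinearMap.id (p.flip y + s.flip y) :
              A ⊗[F] A →ₗ[F] A ⊗[F] A) (cobSucc p s rp rs x)) ↔
    (∀ x y : A,
      (TensorProduct.map (s x) (p y + s y) - TensorProduct.map (p.flip y) (p.flip x + s.flip x)
          - TensorProduct.map (s y) (p x + s x)
          + TensorProduct.map (p.flip x) (p.flip y + s.flip y) :
            A ⊗[F] A →ₗ[F] A ⊗[F] A)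
        (rs + sigmaTensor F A rp) = 0) := by
  refine forall₂_congr fun x y => ?_
  rw [← sub_eq_zero, map_add, coboundary_contribution_succ hA rs,
    coboundary_contribution_prec hA rp]
  refine Eq.congr_left ?_
  simp only [cobPrec, cobSucc, map_add, map_zero, zero_add, add_zero]
  abel
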